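/- arXiv:1403.5300 — 2 statements merged into one kernel-verified Lean document; each statement's English description precedes it below -/
import Mathlib

section
/- Let (A, φ) be a non-commutative probability space and X_1, X_2, ..., X_{n+1} ∈ A. Then R_n(X_1·X_2, X_3, ..., X_{n+1}) = Σ_{i=1}^{n-1} R_i(X_2, X_3, ..., X_{i+1}) · R_{n+1-i}(X_1, X_{i+2}, ..., X_{n+1}) + R_n(X_2, ..., X_{n+1}) · R_1(X_1) + R_{n+1}(X_1, X_2, ..., X_{n+1}). -/
open scoped Classical
open Finset

noncomputable section

namespace FreeProbLukacs

variable {A : Type*}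

/-- Ordered (non-commutative) product of a tuple. -/
def tprod [Monoid A] {n : ℕ} (X : Fin n → A) : A := (List.ofFn X).prod

/-- `P` is a partition of `Fin n`: a finset of nonempty blocks, each point in a unique block. -/
def IsPartition {n : ℕ} (P : Finset (Finset (Fin n))) : Prop :=
  (∀ B ∈ P, B.Nonempty) ∧ ∀ i : Fin n, ∃! B, B ∈ P ∧ i ∈ B

/-- `P` is non-crossing: there are no `a < b < c < d` with `a, c` in one block and
`b, d` in a different block. -/
def IsNonCrossing {n : ℕ} (P : Finset (Finset (Fin n))) : Prop :=
  ∀ B₁ ∈ P, ∀ B₂ ∈ P, ∀ a ∈ B₁, ∀ b ∈ B₂, ∀ c ∈ B₁, ∀ d ∈ B₂,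
    a < b → b < c → c < d → B₁ = B₂

/-- The finset of all non-crossing partitions of `Fin n`. -/
def NC (n : ℕ) : Finset (Finset (Finset (Fin n))) :=
  univ.filter fun P => IsPartition P ∧ IsNonCrossing P

/-- The cumulant functional `R` applied to the entries of `X` lying in a block `B`,
taken in increasing order of position. -/
def blockCum (R : ∀ n, (Fin n → A) → ℂ) {n : ℕ} (X : Fin n → A) (B : Finset (Fin n)) : ℂ :=
  R B.card fun j => X ((B.sort (· ≤ ·)).get (Fin.cast (Finset.length_sort (· ≤ ·)).symm j))

/-- Product of block cumulants over the blocks of a partition. -/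
def partCum (R : ∀ n, (Fin n → A) → ℂ) {n : ℕ} (X : Fin n → A)
    (P : Finset (Finset (Fin n))) : ℂ :=
  ∏ B ∈ P, blockCum R X B

/-- The moment–cumulant formula: `R` is the family of free cumulants of `φ`. -/
def MomentCumulant [Monoid A] (φ : A → ℂ) (R : ∀ n, (Fin n → A) → ℂ) : Prop :=
  ∀ (n : ℕ) (X : Fin n → A), φ (tprod X) = ∑ P ∈ NC n, partCum R X P

/-- Density of the absolutely continuous part of the Marchenko–Pastur law. -/
def freePoissonDensity (l a x : ℝ) : ℝ :=
  Real.sqrt (4 * l * a ^ 2 - (x - a * (1 + l)) ^ 2) / (2 * Real.pi * a * x)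

/-- The free Poisson (Marchenko–Pastur) distribution with rate `l` and jump size `a`. -/
def freePoissonMeasure (l a : ℝ) : MeasureTheory.Measure ℝ :=
  ENNReal.ofReal (max 0 (1 - l)) • MeasureTheory.Measure.dirac 0 +
    MeasureTheory.volume.withDensity fun x => ENNReal.ofReal (freePoissonDensity l a x)

/-- `X` has distribution `μ` in the sense of moments. -/
def HasMoments [Monoid A] (φ : A → ℂ) (X : A) (μ : MeasureTheory.Measure ℝ) : Prop :=
  ∀ r : ℕ, φ (X ^ r) = ((∫ t, t ^ r ∂μ : ℝ) : ℂ)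

/-- `φ` is a state: unital and positive. -/
def IsState [Ring A] [StarRing A] [Module ℂ A] (φ : A →ₗ[ℂ] ℂ) : Prop :=
  φ 1 = 1 ∧ ∀ a : A, ∃ r : ℝ, 0 ≤ r ∧ φ (star a * a) = (r : ℂ)

/-- `φ` is faithful. -/
def Faithful [Ring A] [StarRing A] [Module ℂ A] (φ : A →ₗ[ℂ] ℂ) : Prop :=
  ∀ a : A, φ (star a * a) = 0 → a = 0

/-- `φ` is tracial. -/
def Tracial [Ring A] [Module ℂ A] (φ : A →ₗ[ℂ] ℂ) : Prop :=
  ∀ a b : A, φ (a * b) = φ (b * a)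

/-- All mixed cumulants with entries from `S` and from `T` vanish. -/
def MixedVanish (R : ∀ n, (Fin n → A) → ℂ) (S T : Set A) : Prop :=
  ∀ (n : ℕ) (f : Fin n → A), (∀ i, f i ∈ S ∪ T) → (∃ i, f i ∈ S) → (∃ j, f j ∈ T) →
    R n f = 0

/-- Two elements are free: all their mixed free cumulants vanish. -/
def FreeElems (R : ∀ n, (Fin n → A) → ℂ) (x y : A) : Prop :=
  MixedVanish R {x} {y}

/-- Interleaving of a partition `P` (placed at positions `1,2,…,n`, i.e. evens)
and `Q` (placed at positions `1̄,…,n̄`, i.e. odds) inside `Fin (2 * n)`. -/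
def interleave {n : ℕ} (P Q : Finset (Finset (Fin n))) : Finset (Finset (Fin (2 * n))) :=
  P.image (fun B => B.image fun i => (⟨2 * i.1, by have := i.isLt; omega⟩ : Fin (2 * n)))
    ∪ Q.image (fun B => B.image fun i => (⟨2 * i.1 + 1, by have := i.isLt; omega⟩ : Fin (2 * n)))

/-- `Q` refines ... : every block of `P` is contained in a block of `Q`. -/
def Refines {n : ℕ} (P Q : Finset (Finset (Fin n))) : Prop :=
  ∀ B ∈ P, ∃ C ∈ Q, B ⊆ C

/-- `Q` is the Kreweras complement of `P`: the largest partition whose interleaving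
with `P` is non-crossing. -/
def IsKrewerasComplement {n : ℕ} (P Q : Finset (Finset (Fin n))) : Prop :=
  IsPartition Q ∧ IsNonCrossing (interleave P Q) ∧
    ∀ Q', IsPartition Q' → IsNonCrossing (interleave P Q') → Refines Q' Q

end FreeProbLukacs
namespace FreeProbLukacs

/-- There are no `a < b < c < d` with `a, c ∈ B` and `b, d ∈ C`. -/
def NotCross (B C : Finset ℕ) : Prop :=
  ∀ a ∈ B, ∀ b ∈ C, ∀ c ∈ B, ∀ d ∈ C, a < b → b < c → ¬ c < d

/-- `P` is a non-crossing partition of the finset `s`. -/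
structure IsNCPartition (s : Finset ℕ) (P : Finset (Finset ℕ)) : Prop where
  nonempty : ∀ B ∈ P, B.Nonempty
  subset : ∀ B ∈ P, B ⊆ s
  eq_of_mem : ∀ B ∈ P, ∀ C ∈ P, ∀ i ∈ B, i ∈ C → B = C
  exists_mem : ∀ i ∈ s, ∃ B ∈ P, i ∈ B
  notCross : ∀ B ∈ P, ∀ C ∈ P, B ≠ C → NotCross B C

/-- The finset of all non-crossing partitions of the finset `s`. -/
def ncOn (s : Finset ℕ) : Finset (Finset (Finset ℕ)) :=
  s.powerset.powerset.filter (IsNCPartition s)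

theorem mem_ncOn {s : Finset ℕ} {P : Finset (Finset ℕ)} : P ∈ ncOn s ↔ IsNCPartition s P := by
  simp only [ncOn, mem_filter, mem_powerset, and_iff_right_iff_imp]
  exact fun h B hB => mem_powerset.2 (h.subset B hB)

/-- The non-crossing partitions of `s \ B` that do not cross `B`. -/
def ncCompl (s B : Finset ℕ) : Finset (Finset (Finset ℕ)) :=
  (ncOn (s \ B)).filter fun R => ∀ C ∈ R, NotCross B C ∧ NotCross C B

theorem isNCPartition_insert {s B : Finset ℕ} (hB : B ⊆ s) (hne : B.Nonempty)
    {R : Finset (Finset ℕ)} (hR : R ∈ ncCompl s B) : IsNCPartition s (insert B R) := by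
  simp only [ncCompl, mem_filter, mem_ncOn] at hR
  obtain ⟨⟨h1, h2, h3, h4, h5⟩, h6⟩ := hR
  simp only [subset_iff, mem_sdiff] at *
  constructor
  · grind
  · grind
  · grind
  · intro i hi
    by_cases hiB : i ∈ B
    · exact ⟨B, by simp, hiB⟩
    · obtain ⟨C, hC, hiC⟩ := h4 i ⟨hi, hiB⟩
      exact ⟨C, by simp [hC], hiC⟩
  · grind

theorem notMem_of_mem_ncCompl {s B : Finset ℕ} (hne : B.Nonempty)
    {R : Finset (Finset ℕ)} (hR : R ∈ ncCompl s B) : B ∉ R := by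
  simp only [ncCompl, mem_filter, mem_ncOn] at hR
  intro h
  obtain ⟨x, hx⟩ := hne
  have := hR.1.subset B h hx
  simp_all

theorem erase_mem_ncCompl {s B : Finset ℕ} {P : Finset (Finset ℕ)} (hP : IsNCPartition s P)
    (hB : B ∈ P) : P.erase B ∈ ncCompl s B := by
  obtain ⟨h1, h2, h3, h4, h5⟩ := hP
  simp only [ncCompl, mem_filter, mem_ncOn]
  simp only [subset_iff] at *
  refine ⟨⟨?_, ?_, ?_, ?_, ?_⟩, ?_⟩ <;> simp only [subset_iff, mem_sdiff, mem_erase]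
  · grind
  · grind
  · grind
  · rintro i ⟨hi, hiB⟩
    obtain ⟨C, hC, hiC⟩ := h4 i hi
    exact ⟨C, ⟨fun h => hiB (h ▸ hiC), hC⟩, hiC⟩
  · grind
  · grind

/-- Sorting non-crossing partitions by the block of a given point. -/
theorem sum_ncOn {s : Finset ℕ} {a : ℕ} (ha : a ∈ s) (f : Finset (Finset ℕ) → ℂ) :
    ∑ P ∈ ncOn s, f P =
      ∑ B ∈ s.powerset with a ∈ B, ∑ R ∈ ncCompl s B, f (insert B R) := by
  rw [Finset.sum_sigma']
  symm
  refine Finset.sum_bij (fun x _ => insert x.1 x.2) ?_ ?_ ?_ ?_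
  · rintro ⟨B, R⟩ h
    simp only [mem_sigma, mem_filter, mem_powerset] at h
    exact mem_ncOn.2 (isNCPartition_insert h.1.1 ⟨a, h.1.2⟩ h.2)
  · rintro ⟨B, R⟩ h ⟨B', R'⟩ h' heq
    simp only [mem_sigma, mem_filter, mem_powerset] at h h' heq
    have hP := isNCPartition_insert h.1.1 ⟨a, h.1.2⟩ h.2
    have e : B = B' := hP.eq_of_mem B (by simp) B' (by simp [heq]) a h.1.2 h'.1.2
    subst e
    have h1 := notMem_of_mem_ncCompl ⟨a, h.1.2⟩ h.2
    have h2 := notMem_of_mem_ncCompl ⟨a, h.1.2⟩ h'.2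
    have : R = R' := by rw [← erase_insert h1, heq, erase_insert h2]
    rw [this]
  · intro P hP
    rw [mem_ncOn] at hP
    obtain ⟨B, hB, haB⟩ := hP.exists_mem a ha
    refine ⟨⟨B, P.erase B⟩, ?_, insert_erase hB⟩
    simp only [mem_sigma, mem_filter, mem_powerset]
    exact ⟨⟨hP.subset B hB, haB⟩, erase_mem_ncCompl hP hB⟩
  · simp

/-- `U` is an initial segment of `B` containing `1`. -/
def IsInit (U B : Finset ℕ) : Prop := 1 ∈ U ∧ ∀ x ∈ U, ∀ y ∈ B \ U, x < y

/-- Total weight of the ways to distribute `0` and the elements of a block `B ∋ 1` over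
one or two blocks. -/
def splitWeight (w : Finset ℕ → ℂ) (B : Finset ℕ) : ℂ :=
  w (insert 0 B) + ∑ U ∈ B.powerset with IsInit U B, w U * w (insert 0 (B \ U))

theorem notCross_insert_zero {B C : Finset ℕ} (h1 : 1 ∈ B) (h0C : 0 ∉ C) (h1C : 1 ∉ C) :
    (NotCross (insert 0 B) C ∧ NotCross C (insert 0 B)) ↔ (NotCross B C ∧ NotCross C B) := by
  have key : ∀ b ∈ C, 1 < b := fun b hb => by
    rcases b with _ | _ | b
    · exact absurd hb h0C
    · exact absurd hb h1C
    · omega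
  constructor
  · rintro ⟨h, h'⟩
    exact ⟨fun a ha b hb c hc d hd => h a (by simp [ha]) b hb c (by simp [hc]) d hd,
      fun a ha b hb c hc d hd => h' a ha b (by simp [hb]) c hc d (by simp [hd])⟩
  · rintro ⟨h, h'⟩
    constructor
    · intro a ha b hb c hc d hd hab hbc hcd
      have hc' : c ∈ B := by
        rcases mem_insert.1 hc with rfl | hc
        · omega
        · exact hc
      rcases mem_insert.1 ha with rfl | ha
      · exact h 1 h1 b hb c hc' d hd (key b hb) hbc hcd
      · exact h a ha b hb c hc' d hd hab hbc hcd
    · intro a ha b hb c hc d hd hab hbc hcd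
      have hb' : b ∈ B := by
        rcases mem_insert.1 hb with rfl | hb
        · omega
        · exact hb
      have hd' : d ∈ B := by
        rcases mem_insert.1 hd with rfl | hd
        · omega
        · exact hd
      exact h' a ha b hb' c hc d hd' hab hbc hcd

theorem notCross_split {U V C : Finset ℕ} (h1 : 1 ∈ U)
    (h0C : 0 ∉ C) (h1C : 1 ∉ C) :
    ((NotCross U C ∧ NotCross C U) ∧ NotCross (insert 0 V) C ∧ NotCross C (insert 0 V)) ↔
      (NotCross (U ∪ V) C ∧ NotCross C (U ∪ V)) := by
  have key : ∀ b ∈ C, 1 < b := fun b hb => by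
    rcases b with _ | _ | b
    · exact absurd hb h0C
    · exact absurd hb h1C
    · omega
  constructor
  · rintro ⟨⟨h, h'⟩, k, k'⟩
    constructor
    · intro a ha b hb c hc d hd hab hbc hcd
      rcases mem_union.1 hc with hc | hc
      · exact h 1 h1 b hb c hc d hd (key b hb) hbc hcd
      · exact k 0 (by simp) b hb c (by simp [hc]) d hd (by have := key b hb; omega) hbc hcd
    · intro a ha b hb c hc d hd hab hbc hcd
      rcases mem_union.1 hb with hb | hb
      · exact h 1 h1 a ha b hb c hc (key a ha) hab hbc
      · exact k 0 (by simp) a ha b (by simp [hb]) c hc (by have := key a ha; omega) hab hbc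
  · rintro ⟨h, h'⟩
    refine ⟨⟨?_, ?_⟩, ?_, ?_⟩
    · exact fun a ha b hb c hc d hd => h a (by simp [ha]) b hb c (by simp [hc]) d hd
    · exact fun a ha b hb c hc d hd => h' a ha b (by simp [hb]) c hc d (by simp [hd])
    · intro a ha b hb c hc d hd hab hbc hcd
      rcases mem_insert.1 hc with rfl | hc
      · omega
      · exact h 1 (by simp [h1]) b hb c (by simp [hc]) d hd (key b hb) hbc hcd
    · intro a ha b hb c hc d hd hab hbc hcd
      rcases mem_insert.1 hb with rfl | hb
      · omega
      rcases mem_insert.1 hd with rfl | hd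
      · omega
      exact h' a ha b (by simp [hb]) c hc d (by simp [hd]) hab hbc hcd

theorem notCross_zero_iff {U V : Finset ℕ} (h1 : 1 ∈ U) (h0V : 0 ∉ V)
    (h : Disjoint U V) :
    (NotCross (insert 0 V) U ∧ NotCross U (insert 0 V)) ↔ ∀ x ∈ U, ∀ y ∈ V, x < y := by
  constructor
  · rintro ⟨h2, -⟩ x hx y hy
    by_contra hlt
    have hne : x ≠ y := fun e => Finset.disjoint_left.1 h hx (e ▸ hy)
    have hy1 : y ≠ 1 := fun e => Finset.disjoint_left.1 h h1 (e ▸ hy)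
    have hy0 : y ≠ 0 := fun e => h0V (e ▸ hy)
    exact h2 0 (by simp) 1 h1 y (by simp [hy]) x hx (by omega) (by omega) (by omega)
  · intro h2
    constructor
    · intro a ha b hb c hc d hd hab hbc hcd
      rcases mem_insert.1 hc with rfl | hc
      · omega
      · have := h2 d hd c hc; omega
    · intro a ha b hb c hc d hd hab hbc hcd
      rcases mem_insert.1 hb with rfl | hb
      · omega
      · have := h2 c hc b hb; omega

theorem ncCompl_notMem {s B : Finset ℕ} {R : Finset (Finset ℕ)} (hR : R ∈ ncCompl s B)
    {i : ℕ} (hi : i ∉ s \ B) : ∀ C ∈ R, i ∉ C := by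
  simp only [ncCompl, mem_filter, mem_ncOn] at hR
  exact fun C hC h => hi (hR.1.subset C hC h)

theorem ncCompl_insert_zero {s V : Finset ℕ} (h0 : 0 ∉ s) (h1 : 1 ∈ V) :
    ncCompl (insert 0 s) (insert 0 V) = ncCompl s V := by
  have e : insert 0 s \ insert 0 V = s \ V := by
    ext x; simp only [mem_sdiff, mem_insert]; grind
  ext R
  simp only [ncCompl, mem_filter, e, mem_ncOn]
  refine and_congr_right fun hR => forall₂_congr fun C hC => ?_
  have := hR.subset C hC
  exact notCross_insert_zero h1 (fun h => by simpa [h0] using this h)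
    (fun h => by simpa [h1] using this h)

theorem insert_mem_ncCompl_iff {s U V : Finset ℕ} (h0 : 0 ∉ s) (h1 : 1 ∈ U) (hU : U ⊆ s \ V)
    (hV : V ⊆ s) {R : Finset (Finset ℕ)} :
    (R ∈ ncCompl (s \ V) U ∧ insert U R ∈ ncCompl (insert 0 s) (insert 0 V)) ↔
      (R ∈ ncCompl s (U ∪ V) ∧ ∀ x ∈ U, ∀ y ∈ V, x < y) := by
  have e : insert 0 s \ insert 0 V = s \ V := by
    ext x; simp only [mem_sdiff, mem_insert]; grind
  have e' : (s \ V) \ U = s \ (U ∪ V) := by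
    ext x; simp only [mem_sdiff, mem_union]; grind
  have hd : Disjoint U V := Finset.disjoint_left.2 fun x hx hx' => (mem_sdiff.1 (hU hx)).2 hx'
  have h0V : 0 ∉ V := fun h => h0 (hV h)
  have hz := notCross_zero_iff h1 h0V hd
  have hC : IsNCPartition (s \ (U ∪ V)) R → ∀ C ∈ R, 0 ∉ C ∧ 1 ∉ C := fun hR C hC =>
    ⟨fun h => by simpa [h0] using hR.subset C hC h, fun h => by simpa [h1] using hR.subset C hC h⟩
  constructor
  · rintro ⟨hR, hI⟩
    simp only [ncCompl, mem_filter, e, e', mem_ncOn, mem_insert, forall_eq_or_imp] at hR hI ⊢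
    have hlt := hz.1 hI.2.1
    exact ⟨⟨hR.1, fun C hCR => (notCross_split h1 (hC hR.1 C hCR).1 (hC hR.1 C hCR).2).1
      ⟨hR.2 C hCR, hI.2.2 C hCR⟩⟩, hlt⟩
  · rintro ⟨hR, hlt⟩
    simp only [ncCompl, mem_filter, mem_ncOn] at hR
    have hs := fun C hCR => (notCross_split h1 (hC hR.1 C hCR).1 (hC hR.1 C hCR).2).2
      (hR.2 C hCR)
    have hR' : R ∈ ncCompl (s \ V) U := by
      simp only [ncCompl, mem_filter, e', mem_ncOn]
      exact ⟨hR.1, fun C hCR => (hs C hCR).1⟩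
    refine ⟨hR', ?_⟩
    simp only [ncCompl, mem_filter, e, mem_ncOn, mem_insert, forall_eq_or_imp]
    exact ⟨isNCPartition_insert hU ⟨1, h1⟩ hR', hz.2 hlt, fun C hCR => (hs C hCR).2⟩

/-- Non-crossing partitions of `insert 0 s`, sorted by the partition of `s` obtained by
identifying `0` with `1`. -/
theorem sum_ncOn_insert_zero {s : Finset ℕ} (h0 : 0 ∉ s) (h1 : 1 ∈ s) (w : Finset ℕ → ℂ) :
    ∑ P ∈ ncOn (insert 0 s), ∏ B ∈ P, w B =
      ∑ B ∈ s.powerset with 1 ∈ B, ∑ R ∈ ncCompl s B, splitWeight w B * ∏ C ∈ R, w C := by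
  have hpow : ∑ B ∈ (insert 0 s).powerset with 0 ∈ B,
        ∑ R ∈ ncCompl (insert 0 s) B, ∏ C ∈ insert B R, w C =
      ∑ V ∈ s.powerset, ∑ R ∈ ncCompl (insert 0 s) (insert 0 V), w (insert 0 V) *
        ∏ C ∈ R, w C := by
    symm
    refine Finset.sum_nbij' (fun V => insert 0 V) (fun B => B.erase 0) ?_ ?_ ?_ ?_ ?_
    · intro V hV
      simp only [mem_filter, mem_powerset, mem_insert_self, and_true] at hV ⊢
      exact insert_subset_insert 0 hV
    · intro B hB
      simp only [mem_filter, mem_powerset] at hB ⊢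
      exact subset_insert_iff.1 hB.1
    · intro V hV
      exact erase_insert fun h => h0 (mem_powerset.1 hV h)
    · intro B hB
      exact insert_erase (mem_filter.1 hB).2
    · intro V hV
      refine sum_congr rfl fun R hR => ?_
      rw [prod_insert (notMem_of_mem_ncCompl (by simp) hR)]
  rw [sum_ncOn (mem_insert_self 0 s), hpow, ← sum_filter_add_sum_filter_not _ (fun V => 1 ∈ V)]
  simp only [splitWeight, add_mul, sum_add_distrib]
  congr 1
  · refine sum_congr rfl fun V hV => ?_
    rw [ncCompl_insert_zero h0 (mem_filter.1 hV).2]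
  · have inner : ∀ V ∈ s.powerset.filter (fun V => 1 ∉ V),
        ∑ R ∈ ncCompl (insert 0 s) (insert 0 V), w (insert 0 V) * ∏ C ∈ R, w C =
        ∑ U ∈ (s \ V).powerset with 1 ∈ U, if ∀ x ∈ U, ∀ y ∈ V, x < y then
          ∑ R ∈ ncCompl s (U ∪ V), w U * w (insert 0 V) * ∏ C ∈ R, w C else 0 := by
      intro V hV
      simp only [mem_filter, mem_powerset] at hV
      have e : insert 0 s \ insert 0 V = s \ V := by
        ext x; simp only [mem_sdiff, mem_insert]; grind
      have : ∑ R ∈ ncCompl (insert 0 s) (insert 0 V), w (insert 0 V) * ∏ C ∈ R, w C =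
          ∑ P ∈ ncOn (s \ V), if P ∈ ncCompl (insert 0 s) (insert 0 V) then
            w (insert 0 V) * ∏ C ∈ P, w C else 0 := by
        rw [← sum_filter]
        refine sum_congr ?_ fun _ _ => rfl
        ext P
        simp only [ncCompl, mem_filter, e]
        tauto
      rw [this, sum_ncOn (a := 1) (by simp [h1, hV.2])]
      refine sum_congr rfl fun U hU => ?_
      simp only [mem_filter, mem_powerset] at hU
      have hiff := fun R => insert_mem_ncCompl_iff (R := R) h0 hU.2 hU.1 hV.1
      rw [← sum_filter]
      have hset : (ncCompl (s \ V) U).filter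
          (fun R => insert U R ∈ ncCompl (insert 0 s) (insert 0 V)) =
          if ∀ x ∈ U, ∀ y ∈ V, x < y then ncCompl s (U ∪ V) else ∅ := by
        ext R
        rw [mem_filter, hiff]
        split_ifs with h
        · exact and_iff_left h
        · simp [h]
      have hprod : ∀ R ∈ (ncCompl (s \ V) U).filter
          (fun R => insert U R ∈ ncCompl (insert 0 s) (insert 0 V)),
          w (insert 0 V) * ∏ C ∈ insert U R, w C =
            w U * w (insert 0 V) * ∏ C ∈ R, w C := by
        intro R hR
        rw [prod_insert (notMem_of_mem_ncCompl ⟨1, hU.2⟩ (mem_filter.1 hR).1)]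
        ring
      rw [sum_congr rfl hprod, hset]
      split_ifs <;> simp
    rw [sum_congr rfl inner]
    simp only [sum_mul]
    have swap : ∀ B ∈ s.powerset.filter (fun B => 1 ∈ B),
        (∑ R ∈ ncCompl s B, ∑ U ∈ B.powerset with IsInit U B,
          w U * w (insert 0 (B \ U)) * ∏ C ∈ R, w C) =
        ∑ U ∈ B.powerset with IsInit U B, ∑ R ∈ ncCompl s B,
          w U * w (insert 0 (B \ U)) * ∏ C ∈ R, w C := fun B _ => sum_comm
    rw [sum_congr rfl swap]
    simp only [← sum_filter, filter_filter]
    conv_lhs => rw [sum_sigma']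
    conv_rhs => rw [sum_sigma']
    refine Finset.sum_nbij' (fun x => ⟨x.2 ∪ x.1, x.2⟩) (fun x => ⟨x.1 \ x.2, x.2⟩)
      ?_ ?_ ?_ ?_ ?_
    · rintro ⟨V, U⟩ h
      simp only [mem_sigma, mem_filter, mem_powerset, IsInit, subset_iff, mem_sdiff,
        mem_union] at h ⊢
      grind
    · rintro ⟨B, U⟩ h
      simp only [mem_sigma, mem_filter, mem_powerset, IsInit, subset_iff, mem_sdiff] at h ⊢
      grind
    · rintro ⟨V, U⟩ h
      simp only [mem_sigma, mem_filter, mem_powerset, subset_iff, mem_sdiff] at h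
      simp only [Sigma.mk.injEq, heq_eq_eq, and_true]
      ext x; simp only [mem_sdiff, mem_union]; grind
    · rintro ⟨B, U⟩ h
      simp only [mem_sigma, mem_filter, mem_powerset] at h
      simp [union_sdiff_of_subset h.2.1]
    · rintro ⟨V, U⟩ h
      simp only [mem_sigma, mem_filter, mem_powerset, subset_iff, mem_sdiff] at h
      have : (U ∪ V) \ U = V := by
        ext x; simp only [mem_sdiff, mem_union]; grind
      simp [this]

/-- The cumulant of the entries of `X` with positions in `B`, in increasing order. -/
def cumOn {A : Type*} (R : ∀ n, (Fin n → A) → ℂ) (X : ℕ → A) (B : Finset ℕ) : ℂ :=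
  R B.card fun j => X (B.orderEmbOfFin rfl j)

theorem cumOn_eq {A : Type*} (R : ∀ n, (Fin n → A) → ℂ) (X : ℕ → A) {B : Finset ℕ} {k : ℕ}
    (f : Fin k → ℕ) (hf : StrictMono f) (hB : univ.image f = B) :
    cumOn R X B = R k fun j => X (f j) := by
  have hk : B.card = k := by
    rw [← hB, card_image_of_injective _ hf.injective, card_univ, Fintype.card_fin]
  subst hk
  have : f = B.orderEmbOfFin rfl :=
    orderEmbOfFin_unique rfl (fun x => hB ▸ mem_image_of_mem f (mem_univ x)) hf
  rw [this, cumOn]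

theorem blockCum_eq_cumOn {A : Type*} (R : ∀ n, (Fin n → A) → ℂ) (X : ℕ → A) {n : ℕ}
    {f : Fin n → ℕ} (hf : StrictMono f) (B : Finset (Fin n)) :
    blockCum R (fun j => X (f j)) B = cumOn R X (B.image f) := by
  rw [cumOn_eq R X (fun j => f (B.orderEmbOfFin rfl j))
    (hf.comp (B.orderEmbOfFin rfl).strictMono)]
  · rfl
  · conv_rhs => rw [← image_orderEmbOfFin_univ B rfl, image_image]
    rfl

theorem moment_eq {A : Type*} [Monoid A] {φ : A → ℂ} {R : ∀ n, (Fin n → A) → ℂ}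
    (hmc : MomentCumulant φ R) (X : ℕ → A) {n : ℕ} (f : Fin n → ℕ) (hf : StrictMono f) :
    φ (tprod fun j => X (f j)) = ∑ P ∈ ncOn (univ.image f), ∏ B ∈ P, cumOn R X B := by
  have hinj : Function.Injective fun B : Finset (Fin n) => B.image f :=
    image_injective hf.injective
  rw [hmc]
  refine sum_bij (fun P _ => P.image fun B => B.image f) ?_ ?_ ?_ ?_
  · intro P hP
    obtain ⟨-, ⟨h1, h2⟩, h3⟩ := mem_filter.1 hP
    rw [mem_ncOn]
    constructor
    · simp only [forall_mem_image, image_nonempty]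
      exact h1
    · simp only [forall_mem_image]
      exact fun B _ => image_subset_image (subset_univ B)
    · simp only [forall_mem_image]
      intro B hB C hC i hi hi'
      rw [hf.injective.mem_finset_image] at hi'
      rw [(h2 i).unique ⟨hB, hi⟩ ⟨hC, hi'⟩]
    · simp only [forall_mem_image, exists_mem_image, hf.injective.mem_finset_image]
      intro i _
      obtain ⟨B, hB, -⟩ := h2 i
      exact ⟨B, hB⟩
    · simp only [forall_mem_image, NotCross, hf.lt_iff_lt]
      intro B hB C hC hne a ha b hb c hc d hd hab hbc hcd
      exact hne (by rw [h3 B hB C hC a ha b hb c hc d hd hab hbc hcd])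
  · exact fun P _ Q _ h => image_injective hinj h
  · intro P hP
    rw [mem_ncOn] at hP
    obtain ⟨h1, h2, h3, h4, h5⟩ := hP
    have himg : ∀ B ∈ P, (univ.filter fun i => f i ∈ B).image f = B := by
      intro B hB
      ext x
      simp only [mem_image, mem_filter, mem_univ, true_and]
      constructor
      · rintro ⟨i, hi, rfl⟩
        exact hi
      · intro hx
        obtain ⟨i, -, rfl⟩ := mem_image.1 (h2 B hB hx)
        exact ⟨i, hx, rfl⟩
    refine ⟨P.image fun B => univ.filter fun i => f i ∈ B, ?_, ?_⟩
    · refine mem_filter.2 ⟨mem_univ _, ⟨?_, ?_⟩, ?_⟩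
      · simp only [forall_mem_image]
        intro B hB
        rw [← image_nonempty (f := f), himg B hB]
        exact h1 B hB
      · intro i
        obtain ⟨B, hB, hi⟩ := h4 (f i) (mem_image_of_mem f (mem_univ i))
        refine ⟨univ.filter fun i => f i ∈ B, ⟨mem_image_of_mem _ hB, by simpa using hi⟩, ?_⟩
        rintro C ⟨hC, hiC⟩
        obtain ⟨C, hC', rfl⟩ := mem_image.1 hC
        rw [h3 B hB C hC' (f i) hi (by simpa using hiC)]
      · simp only [IsNonCrossing, forall_mem_image, mem_filter, mem_univ, true_and]
        intro B hB C hC a ha b hb c hc d hd hab hbc hcd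
        by_contra hne
        exact h5 B hB C hC (fun e => hne (by rw [e])) (f a) ha (f b) hb (f c) hc (f d) hd
          (hf hab) (hf hbc) (hf hcd)
    · rw [image_image]
      conv_rhs => rw [← image_id (s := P)]
      exact image_congr fun B hB => himg B hB
  · intro P _
    rw [partCum, prod_image fun B _ C _ h => hinj h]
    exact prod_congr rfl fun B _ => blockCum_eq_cumOn R X hf B

theorem tprod_succ {A : Type*} [Monoid A] {n : ℕ} (X : Fin (n + 1) → A) :
    tprod X = X 0 * tprod fun j : Fin n => X j.succ := by
  simp [tprod, List.ofFn_succ]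

theorem ncCompl_self (s : Finset ℕ) : ncCompl s s = {∅} := by
  ext R
  simp only [ncCompl, mem_filter, mem_ncOn, sdiff_self, mem_singleton]
  constructor
  · rintro ⟨h, -⟩
    by_contra hne
    obtain ⟨B, hB⟩ := nonempty_iff_ne_empty.2 hne
    obtain ⟨x, hx⟩ := h.nonempty B hB
    simpa using h.subset B hB hx
  · rintro rfl
    exact ⟨by constructor <;> simp, by simp⟩

theorem cumOn_update {A : Type*} [Monoid A] {φ : A → ℂ} {R : ∀ n, (Fin n → A) → ℂ}
    (hmc : MomentCumulant φ R) (X : ℕ → A) (s : Finset ℕ) (h0 : 0 ∉ s) (h1 : 1 ∈ s) :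
    cumOn R (Function.update X 1 (X 0 * X 1)) s = splitWeight (cumOn R X) s := by
  induction s using Finset.strongInduction with
  | H s ih =>
  set Y := Function.update X 1 (X 0 * X 1) with hY
  obtain ⟨k, hk⟩ : ∃ k, s.card = k + 1 :=
    ⟨s.card - 1, by have := card_pos.2 ⟨1, h1⟩; omega⟩
  have hpos : ∀ x ∈ s, 1 ≤ x := fun x hx =>
    Nat.one_le_iff_ne_zero.2 fun h => h0 (h ▸ hx)
  set f : Fin (k + 1) → ℕ := ⇑(s.orderEmbOfFin hk)
  have hf : StrictMono f := (s.orderEmbOfFin hk).strictMono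
  have hfs : univ.image f = s := image_orderEmbOfFin_univ s hk
  have hmem : ∀ i, f i ∈ s := fun i => orderEmbOfFin_mem s hk i
  have hf0 : f 0 = 1 := by
    obtain ⟨i, -, hi⟩ := mem_image.1 (hfs.symm ▸ h1)
    have := hf.monotone (Fin.zero_le i)
    have := hpos _ (hmem 0)
    omega
  have hfpos : ∀ i : Fin k, f i.succ ≠ 1 := fun i h => by
    have := hf (Fin.succ_pos i)
    omega
  have hg : StrictMono (Fin.cons 0 f : Fin (k + 2) → ℕ) := by
    rw [Fin.strictMono_iff_lt_succ]
    intro i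
    refine Fin.cases ?_ (fun i => ?_) i
    · exact hpos _ (hmem 0)
    · rw [Fin.castSucc_succ, Fin.cons_succ, Fin.cons_succ]
      exact hf (Fin.castSucc_lt_succ)
  have hgs : univ.image (Fin.cons 0 f : Fin (k + 2) → ℕ) = insert 0 s := by
    ext x
    simp only [mem_image, mem_univ, true_and, Fin.exists_fin_succ, Fin.cons_zero, Fin.cons_succ,
      mem_insert, ← hfs]
    tauto
  have hprod : (tprod fun j => Y (f j)) =
      tprod fun j => X ((Fin.cons 0 f : Fin (k + 2) → ℕ) j) := by
    rw [tprod_succ, tprod_succ, tprod_succ]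
    simp only [Fin.cons_zero, Fin.cons_succ, hf0, ← mul_assoc]
    simp [hY, Function.update_of_ne (hfpos _)]
  have hmom := moment_eq hmc Y f hf
  rw [hprod, moment_eq hmc X _ hg, hgs, hfs, sum_ncOn_insert_zero h0 h1, sum_ncOn h1] at hmom
  have hs : s ∈ s.powerset.filter (fun B => 1 ∈ B) := by simp [h1]
  rw [← add_sum_erase _ _ hs, ← add_sum_erase _ _ hs] at hmom
  have hrest : ∀ B ∈ (s.powerset.filter (fun B => 1 ∈ B)).erase s,
      ∑ Q ∈ ncCompl s B, splitWeight (cumOn R X) B * ∏ C ∈ Q, cumOn R X C =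
        ∑ Q ∈ ncCompl s B, ∏ C ∈ insert B Q, cumOn R Y C := by
    intro B hB
    simp only [mem_erase, mem_filter, mem_powerset] at hB
    refine sum_congr rfl fun Q hQ => ?_
    rw [prod_insert (notMem_of_mem_ncCompl ⟨1, hB.2.2⟩ hQ),
      ih B (hB.2.1.ssubset_of_ne hB.1) (fun h => h0 (hB.2.1 h)) hB.2.2]
    congr 1
    refine prod_congr rfl fun C hC => ?_
    have h1C : 1 ∉ C := ncCompl_notMem hQ (by simp [hB.2.2]) C hC
    unfold cumOn
    congr 1
    ext j
    rw [hY, Function.update_of_ne (ne_of_mem_of_not_mem (orderEmbOfFin_mem C rfl j) h1C)]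
  rw [sum_congr rfl hrest] at hmom
  simpa [ncCompl_self] using (add_right_cancel hmom).symm

theorem filter_isInit_Icc (m : ℕ) :
    (Icc 1 (m + 1)).powerset.filter (fun U => IsInit U (Icc 1 (m + 1))) =
      (range (m + 1)).image fun k => Icc 1 (k + 1) := by
  ext U
  rw [mem_filter, mem_powerset]
  simp only [IsInit, mem_image, mem_range]
  constructor
  · rintro ⟨hU, h1, hlt⟩
    obtain ⟨k, hmax, hle⟩ : ∃ k ∈ U, ∀ x ∈ U, x ≤ k :=
      ⟨_, U.max'_mem ⟨1, h1⟩, fun x hx => U.le_max' x hx⟩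
    have hk := mem_Icc.1 (hU hmax)
    refine ⟨k - 1, by omega, ?_⟩
    ext x
    rw [mem_Icc]
    constructor
    · intro hx
      by_contra hxU
      have := hlt k hmax x (mem_sdiff.2 ⟨mem_Icc.2 (by omega), hxU⟩)
      omega
    · intro hx
      have := hle x hx
      have := mem_Icc.1 (hU hx)
      omega
  · rintro ⟨k, hk, rfl⟩
    refine ⟨Icc_subset_Icc_right (by omega), by simp, ?_⟩
    simp only [mem_sdiff, mem_Icc]
    omega

theorem splitWeight_Icc (w : Finset ℕ → ℂ) (m : ℕ) :
    splitWeight w (Icc 1 (m + 1)) = w (insert 0 (Icc 1 (m + 1))) +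
      ∑ k ∈ range (m + 1), w (Icc 1 (k + 1)) * w (insert 0 (Icc (k + 2) (m + 1))) := by
  rw [splitWeight, filter_isInit_Icc, sum_image]
  · refine congr_arg₂ _ rfl (sum_congr rfl fun k _ => ?_)
    have : Icc 1 (m + 1) \ Icc 1 (k + 1) = Icc (k + 2) (m + 1) := by
      ext x; simp only [mem_sdiff, mem_Icc]; omega
    rw [this]
  · intro k _ l _ h
    have := congr_arg Finset.card h
    simpa using this

theorem cumOn_Icc {A : Type*} (R : ∀ n, (Fin n → A) → ℂ) (X : ℕ → A) (k : ℕ) :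
    cumOn R X (Icc 1 k) = R k fun j => X (j + 1) := by
  refine cumOn_eq R X (fun j : Fin k => (j : ℕ) + 1) (fun i j h => by simpa using h) ?_
  ext x
  simp only [mem_image, mem_univ, true_and, mem_Icc]
  constructor
  · rintro ⟨i, rfl⟩
    omega
  · intro h
    exact ⟨⟨x - 1, by omega⟩, by simp; omega⟩

theorem cumOn_insert_zero_Icc {A : Type*} (R : ∀ n, (Fin n → A) → ℂ) (X : ℕ → A) {k m : ℕ}
    (h : k ≤ m) :
    cumOn R X (insert 0 (Icc (k + 1) m)) =
      R (m + 1 - k) fun j => if (j : ℕ) = 0 then X 0 else X (k + j) := by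
  rw [cumOn_eq R X (fun j : Fin (m + 1 - k) => if (j : ℕ) = 0 then 0 else k + j)]
  · simp only [apply_ite X]
  · intro i j hij
    have : (i : ℕ) < j := hij
    dsimp only
    split_ifs <;> omega
  · ext x
    simp only [mem_image, mem_univ, true_and, mem_insert, mem_Icc]
    constructor
    · rintro ⟨i, rfl⟩
      split_ifs <;> omega
    · intro hx
      by_cases h0 : x = 0
      · exact ⟨⟨0, by omega⟩, by simp [h0]⟩
      · refine ⟨⟨x - k, by omega⟩, ?_⟩
        dsimp only
        split_ifs <;> omega

/-- the formula for a free cumulant with a product as its first entry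
(here `n = m + 1`, and `X 0, …, X (m+1)` play the roles of `X_1, …, X_{n+1}`):
`R_n(X_1·X_2, X_3, …, X_{n+1}) = ∑_{i=1}^{n-1} R_i(X_2,…,X_{i+1})·R_{n+1-i}(X_1,X_{i+2},…,X_{n+1})
 + R_n(X_2,…,X_{n+1})·R_1(X_1) + R_{n+1}(X_1,…,X_{n+1})`. -/
theorem cumulant_product_first_entry
    {A : Type*} [Ring A] [Algebra ℂ A]
    (φ : A →ₗ[ℂ] ℂ) (R : ∀ n, (Fin n → A) → ℂ)
    (hmc : MomentCumulant (⇑φ) R)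
    (m : ℕ) (X : Fin (m + 2) → A) :
    R (m + 1) (Fin.cons (X 0 * X 1) (fun j : Fin m => X j.succ.succ)) =
      (∑ t : Fin m,
        R (t.1 + 1)
            (fun j : Fin (t.1 + 1) => X ⟨j.1 + 1, by have := j.isLt; have := t.isLt; omega⟩) *
          R (m + 1 - t.1)
            (fun j : Fin (m + 1 - t.1) =>
              if j.1 = 0 then X 0 else X ⟨t.1 + 1 + j.1, by have := j.isLt; omega⟩))
        + R (m + 1) (fun j : Fin (m + 1) => X j.succ) * R 1 (fun _ => X 0)
        + R (m + 2) X := by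
  set Z : ℕ → A := fun i => if h : i < m + 2 then X ⟨i, h⟩ else 0
  have hZX : ∀ i (h : i < m + 2), Z i = X ⟨i, h⟩ := fun i h => dif_pos h
  have key := cumOn_update hmc Z (Icc 1 (m + 1)) (by simp) (by simp)
  rw [splitWeight_Icc, cumOn_Icc, cumOn_insert_zero_Icc R Z (Nat.zero_le _), sum_range_succ,
    sum_range, add_comm (R _ _)] at key
  refine Eq.trans (Eq.trans (congr_arg _ (funext fun j => ?_)) key)
    (congr_arg₂ _ (congr_arg₂ _ (sum_congr rfl fun t _ => ?_) ?_) (congr_arg _ (funext fun j => ?_)))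
  · refine Fin.cases ?_ (fun j => ?_) j
    · simp [hZX]
    · rw [Function.update_of_ne (by simp), hZX _ (by simp)]
      rfl
  · rw [cumOn_Icc, cumOn_insert_zero_Icc R Z (by omega),
      show m + 1 + 1 - (t.1 + 1) = m + 1 - t.1 by omega]
    refine congr_arg₂ _ (congr_arg _ (funext fun j => ?_)) (congr_arg _ (funext fun j => ?_))
    · rw [hZX _ (by omega)]
    · rw [hZX 0 (by omega), hZX _ (by omega)]
      rfl
  · rw [cumOn_Icc, cumOn_insert_zero_Icc R Z le_rfl, show m + 1 + 1 - (m + 1) = 1 by omega]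
    refine congr_arg₂ _ (congr_arg _ (funext fun j => ?_)) (congr_arg _ (funext fun j => ?_))
    · rw [hZX _ (by omega)]
      rfl
    · rw [if_pos (by omega), hZX 0 (by omega)]
      rfl
  · rw [hZX 0 (by omega)]
    split_ifs with h
    · exact congr_arg X (Fin.ext h.symm)
    · rw [hZX _ (by omega)]
      simp

end FreeProbLukacs
end
end

section
/- Let X have the free Poisson distribution with rate λ > 1 and jump size α = 1. Then the mixed second cumulant satisfies R_2(X^{-1}, X) = −1/(λ−1) = −R_1(X^{-1}). -/
open scoped Classical
open Finset

noncomputable section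

namespace FreeProbLukacs

section

open MeasureTheory Polynomial

theorem IsState.norm_sq_apply_mul_le {A : Type*} [Ring A] [StarRing A] [Algebra ℂ A]
    [StarModule ℂ A] {φ : A →ₗ[ℂ] ℂ} (hst : IsState φ) {u v : A} (hu : IsSelfAdjoint u)
    (hv : IsSelfAdjoint v) (huv : Commute u v) :
    ‖φ (u * v)‖ ^ 2 ≤ (φ (u * u)).re * (φ (v * v)).re := by
  have hsq : ∀ w : A, IsSelfAdjoint w → 0 ≤ (φ (w * w)).re ∧ (φ (w * w)).im = 0 := by
    intro w hw
    obtain ⟨r, hr, h⟩ := hst.2 w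
    rw [hw.star_eq] at h
    simp [h, hr]
  have key : ∀ c : ℝ, φ ((u + (c : ℂ) • v) * (u + (c : ℂ) • v)) =
      φ (u * u) + 2 * c * φ (u * v) + c * c * φ (v * v) := by
    intro c
    simp only [add_mul, mul_add, smul_mul_assoc, mul_smul_comm, map_add, map_smul, smul_eq_mul,
      ← huv.eq]
    ring
  have hsa : ∀ c : ℝ, IsSelfAdjoint (u + (c : ℂ) • v) := by
    intro c
    rw [IsSelfAdjoint, star_add, star_smul, hu.star_eq, hv.star_eq]
    simp
  have him : (φ (u * v)).im = 0 := by
    have h := (hsq _ (hsa 1)).2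
    rw [key] at h
    simpa [(hsq u hu).2, (hsq v hv).2] using h
  have hdisc := discrim_le_zero (a := (φ (v * v)).re) (b := 2 * (φ (u * v)).re)
    (c := (φ (u * u)).re) fun c => by
      have h := (hsq _ (hsa c)).1
      rw [key] at h
      simp at h
      linarith
  rw [discrim] at hdisc
  rw [← Complex.normSq_eq_norm_sq, Complex.normSq_apply, him]
  linarith

theorem isSelfAdjoint_aeval_map_ofReal {A : Type*} [Ring A] [StarRing A] [Algebra ℂ A]
    [StarModule ℂ A] {X : A} (hX : IsSelfAdjoint X) (p : ℝ[X]) :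
    IsSelfAdjoint (aeval X (p.map Complex.ofRealHom)) := by
  induction p using Polynomial.induction_on' with
  | add p q hp hq => simpa using hp.add hq
  | monomial n c =>
    rw [map_monomial, aeval_monomial, ← Algebra.smul_def, IsSelfAdjoint, star_smul,
      (hX.pow n).star_eq]
    simp

theorem apply_aeval_map_ofReal {A : Type*} [Ring A] [Algebra ℂ A] {φ : A →ₗ[ℂ] ℂ} {X : A}
    {μ : Measure ℝ} (hmom : HasMoments φ X μ) (hint : ∀ n : ℕ, Integrable (fun t : ℝ => t ^ n) μ)
    (p : ℝ[X]) :
    Integrable (fun t => p.eval t) μ ∧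
      φ (aeval X (p.map Complex.ofRealHom)) = ((∫ t, p.eval t ∂μ : ℝ) : ℂ) := by
  induction p using Polynomial.induction_on' with
  | add p q hp hq =>
    simp only [eval_add, Polynomial.map_add, map_add]
    refine ⟨hp.1.add hq.1, ?_⟩
    rw [hp.2, hq.2, integral_add hp.1 hq.1]
    simp
  | monomial n c =>
    simp only [eval_monomial]
    refine ⟨(hint n).const_mul c, ?_⟩
    rw [map_monomial, aeval_monomial, ← Algebra.smul_def, map_smul, hmom n, integral_const_mul]
    simp

/-- If the moments of an invertible self-adjoint element are those of a measure supported in a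
compact interval of positive reals, then its inverse has the expected first moment. -/
theorem apply_inverse_eq_integral_inv {A : Type*} [Ring A] [StarRing A] [Algebra ℂ A]
    [StarModule ℂ A] {φ : A →ₗ[ℂ] ℂ} (hst : IsState φ) {X : A} (hX : IsSelfAdjoint X)
    (hU : IsUnit X) {μ : Measure ℝ} [IsProbabilityMeasure μ] (hmom : HasMoments φ X μ)
    {a b : ℝ} (ha : 0 < a) (hμ : ∀ᵐ t ∂μ, t ∈ Set.Icc a b) :
    φ (Ring.inverse X) = ((∫ t, t⁻¹ ∂μ : ℝ) : ℂ) := by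
  have hbdd : ∀ g : ℝ → ℝ, AEStronglyMeasurable g μ → ContinuousOn g (Set.Icc a b) →
      Integrable g μ := by
    intro g hg hc
    obtain ⟨C, hC⟩ := isCompact_Icc.exists_bound_of_continuousOn hc
    exact Integrable.of_bound hg C (hμ.mono fun t ht => hC t ht)
  have hint : ∀ n : ℕ, Integrable (fun t : ℝ => t ^ n) μ := fun n =>
    hbdd _ (by fun_prop) (by fun_prop)
  have hinvc : ContinuousOn (fun t : ℝ => t⁻¹) (Set.Icc a b) :=
    continuousOn_inv₀.mono fun t ht => (ha.trans_le ht.1).ne'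
  have hinv : Integrable (fun t : ℝ => t⁻¹) μ :=
    hbdd _ measurable_inv.aestronglyMeasurable hinvc
  have hYsa : IsSelfAdjoint (Ring.inverse X) := by
    rw [IsSelfAdjoint, ← Ring.inverse_star, hX.star_eq]
  set K : ℝ := (φ (Ring.inverse X * Ring.inverse X)).re with hK
  have hK0 : 0 ≤ K := by
    obtain ⟨r, hr, h⟩ := hst.2 (Ring.inverse X)
    rw [hYsa.star_eq] at h
    simpa [hK, h] using hr
  have hbound : ∀ δ > 0, ‖φ (Ring.inverse X) - ((∫ t, t⁻¹ ∂μ : ℝ) : ℂ)‖ ≤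
      (√K * |b| + 1) * δ := by
    intro δ hδ
    obtain ⟨p, hp⟩ := exists_polynomial_near_of_continuousOn a b _ hinvc δ hδ
    set q : ℝ[X] := 1 - Polynomial.X * p with hq
    set V : A := aeval X (q.map Complex.ofRealHom) with hV
    have hVsa : IsSelfAdjoint V := isSelfAdjoint_aeval_map_ofReal hX q
    have hXV : Commute X V := by
      rw [hV, Commute, SemiconjBy]
      calc X * aeval X (q.map Complex.ofRealHom)
          = aeval X (Polynomial.X * q.map Complex.ofRealHom) := by rw [map_mul, aeval_X]
        _ = aeval X (q.map Complex.ofRealHom) * X := by rw [mul_comm, map_mul, aeval_X]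
    have hcomm : Commute (Ring.inverse X) V := by
      obtain ⟨u, hu⟩ := hU
      rw [← hu] at hXV ⊢
      rw [Ring.inverse_unit]
      exact hXV.units_inv_left
    have hYV : Ring.inverse X * V =
        Ring.inverse X - aeval X (p.map Complex.ofRealHom) := by
      simp only [hV, hq, Polynomial.map_sub, Polynomial.map_one, Polynomial.map_mul, map_X,
        map_sub, map_one, map_mul, aeval_X, mul_sub, mul_one]
      rw [← mul_assoc, Ring.inverse_mul_cancel _ hU, one_mul]
    have hcs := hst.norm_sq_apply_mul_le hYsa hVsa hcomm
    have hVV : V * V = aeval X ((q * q).map Complex.ofRealHom) := by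
      simp [hV]
    have hqq := apply_aeval_map_ofReal hmom hint (q * q)
    have hVbound : (φ (V * V)).re ≤ (|b| * δ) ^ 2 := by
      rw [hVV, hqq.2, Complex.ofReal_re]
      have h : ∫ t, (q * q).eval t ∂μ ≤ ∫ _, (|b| * δ) ^ 2 ∂μ := by
        refine integral_mono_ae hqq.1 (integrable_const _) (hμ.mono fun t ht => ?_)
        have ht0 : 0 < t := ha.trans_le ht.1
        have hqt : q.eval t = -(t * (p.eval t - t⁻¹)) := by
          simp [hq]
          field_simp
          ring
        have habs : |q.eval t| ≤ |b| * δ := by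
          rw [hqt, abs_neg, abs_mul]
          exact mul_le_mul (abs_le_abs_of_nonneg ht0.le ht.2) (hp t ht).le (abs_nonneg _)
            (abs_nonneg _)
        simp only [eval_mul]
        rw [← sq]
        exact sq_le_sq' (abs_le.1 habs).1 (abs_le.1 habs).2
      simpa using h
    have hfst : ‖φ (Ring.inverse X) - φ (aeval X (p.map Complex.ofRealHom))‖ ≤
        √K * (|b| * δ) := by
      rw [← map_sub, ← hYV]
      refine le_of_sq_le_sq ?_ (by positivity)
      rw [mul_pow, Real.sq_sqrt hK0]
      exact hcs.trans (mul_le_mul_of_nonneg_left hVbound hK0)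
    have hpp := apply_aeval_map_ofReal hmom hint p
    have hsnd : ‖φ (aeval X (p.map Complex.ofRealHom)) - ((∫ t, t⁻¹ ∂μ : ℝ) : ℂ)‖ ≤ δ := by
      rw [hpp.2, ← Complex.ofReal_sub, ← integral_sub hpp.1 hinv, Complex.norm_real]
      have h := norm_integral_le_of_norm_le_const (μ := μ) (C := δ)
        (f := fun t => p.eval t - t⁻¹) (hμ.mono fun t ht => (hp t ht).le)
      simpa using h
    have := norm_sub_le_norm_sub_add_norm_sub (φ (Ring.inverse X))
      (φ (aeval X (p.map Complex.ofRealHom))) ((∫ t, t⁻¹ ∂μ : ℝ) : ℂ)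
    linarith
  have hC : 0 < √K * |b| + 1 := by positivity
  rw [← sub_eq_zero, ← norm_le_zero_iff]
  refine le_of_forall_pos_le_add fun ε hε => ?_
  have h := hbound (ε / (√K * |b| + 1)) (by positivity)
  rw [mul_div_cancel₀ _ hC.ne'] at h
  linarith

theorem four_mul_sub_sq_eq {l : ℝ} (hl : 0 ≤ l) (t : ℝ) :
    4 * l - (t - (1 + l)) ^ 2 = (t - (√l - 1) ^ 2) * ((√l + 1) ^ 2 - t) := by
  have h := Real.sq_sqrt hl
  nth_rewrite 1 2 [← h]
  ring

theorem freePoissonDensity_eq_zero_of_notMem {l t : ℝ} (hl : 0 ≤ l)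
    (ht : t ∉ Set.Icc ((√l - 1) ^ 2) ((√l + 1) ^ 2)) : freePoissonDensity l 1 t = 0 := by
  have hab : (√l - 1) ^ 2 ≤ (√l + 1) ^ 2 := by nlinarith [Real.sqrt_nonneg l]
  have h : 4 * l * 1 ^ 2 - (t - 1 * (1 + l)) ^ 2 ≤ 0 := by
    rw [one_pow, mul_one, one_mul, four_mul_sub_sq_eq hl]
    rw [Set.mem_Icc, not_and_or, not_le, not_le] at ht
    rcases ht with ht | ht <;> nlinarith
  rw [freePoissonDensity, Real.sqrt_eq_zero_of_nonpos h, zero_div]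

theorem measurable_freePoissonDensity (l a : ℝ) : Measurable (freePoissonDensity l a) := by
  unfold freePoissonDensity
  fun_prop

theorem freePoissonMeasure_eq_withDensity {l : ℝ} (hl : 1 ≤ l) (a : ℝ) :
    freePoissonMeasure l a =
      volume.withDensity fun x => ENNReal.ofReal (freePoissonDensity l a x) := by
  rw [freePoissonMeasure, max_eq_left (by linarith)]
  simp

theorem ae_mem_Icc_freePoissonMeasure {l : ℝ} (hl : 1 ≤ l) :
    ∀ᵐ t ∂freePoissonMeasure l 1, t ∈ Set.Icc ((√l - 1) ^ 2) ((√l + 1) ^ 2) := by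
  rw [freePoissonMeasure_eq_withDensity hl,
    ae_withDensity_iff (measurable_freePoissonDensity l 1).ennreal_ofReal]
  refine Filter.Eventually.of_forall fun t ht => ?_
  by_contra hmem
  exact ht (by simp [freePoissonDensity_eq_zero_of_notMem (by linarith) hmem])

theorem integral_freePoissonMeasure {l : ℝ} (hl : 1 < l) (g : ℝ → ℝ) :
    ∫ t, g t ∂freePoissonMeasure l 1 =
      (∫ t in ((√l - 1) ^ 2)..((√l + 1) ^ 2), √(4 * l - (t - (1 + l)) ^ 2) / t * g t) /
        (2 * Real.pi) := by
  have hl0 : 0 ≤ l := by linarith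
  have hab : (√l - 1) ^ 2 ≤ (√l + 1) ^ 2 := by nlinarith [Real.sqrt_nonneg l]
  have ha : 0 < (√l - 1) ^ 2 := by
    have : 1 < √l := by rwa [Real.lt_sqrt zero_le_one, one_pow]
    have : 0 < √l - 1 := by linarith
    positivity
  rw [freePoissonMeasure_eq_withDensity hl.le, integral_withDensity_eq_integral_toReal_smul
    (measurable_freePoissonDensity l 1).ennreal_ofReal (by simp)]
  rw [← setIntegral_eq_integral_of_forall_compl_eq_zero
    (s := Set.Icc ((√l - 1) ^ 2) ((√l + 1) ^ 2)) fun t ht => by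
      simp [freePoissonDensity_eq_zero_of_notMem hl0 ht]]
  rw [intervalIntegral.integral_of_le hab, ← integral_Icc_eq_integral_Ioc, ← integral_div]
  refine setIntegral_congr_fun measurableSet_Icc fun t ht => ?_
  have ht0 : 0 < t := ha.trans_le ht.1
  have hd : 0 ≤ freePoissonDensity l 1 t := by
    unfold freePoissonDensity
    positivity
  simp only [ENNReal.toReal_ofReal hd, smul_eq_mul]
  simp only [freePoissonDensity, one_pow, mul_one, one_mul]
  field_simp

theorem integral_sqrt_four_mul_sub_sq {l : ℝ} (hl : 0 < l) :
    ∫ t in ((√l - 1) ^ 2)..((√l + 1) ^ 2), √(4 * l - (t - (1 + l)) ^ 2) = 2 * Real.pi * l := by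
  have hs : 0 < √l := Real.sqrt_pos.2 hl
  have hsq : √l ^ 2 = l := Real.sq_sqrt hl.le
  have h := intervalIntegral.integral_comp_mul_add
    (f := fun t : ℝ => √(4 * l - (t - (1 + l)) ^ 2)) (a := -1) (b := 1)
    (c := 2 * √l) (by positivity) (1 + l)
  have e : ∀ x : ℝ, √(4 * l - (2 * √l * x + (1 + l) - (1 + l)) ^ 2) =
      2 * √l * √(1 - x ^ 2) := by
    intro x
    rw [← Real.sqrt_sq (by positivity : 0 ≤ 2 * √l), ← Real.sqrt_mul (by positivity)]
    congr 1
    rw [Real.sqrt_sq (by positivity : 0 ≤ 2 * √l)]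
    linear_combination (-4) * hsq
  simp only [e, intervalIntegral.integral_const_mul, integral_sqrt_one_sub_sq, smul_eq_mul] at h
  rw [show (√l - 1) ^ 2 = 2 * √l * -1 + (1 + l) by linear_combination hsq,
    show (√l + 1) ^ 2 = 2 * √l * 1 + (1 + l) by linear_combination hsq]
  rw [inv_mul_eq_div, eq_div_iff (by positivity)] at h
  rw [← h]
  linear_combination (2 * Real.pi) * hsq

theorem integral_id_freePoissonMeasure {l : ℝ} (hl : 1 < l) :
    ∫ t, t ∂freePoissonMeasure l 1 = l := by
  have hl0 : 0 < l := by linarith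
  have hab : (√l - 1) ^ 2 ≤ (√l + 1) ^ 2 := by nlinarith [Real.sqrt_nonneg l]
  have h1 : 1 < √l := by rwa [Real.lt_sqrt zero_le_one, one_pow]
  have ha : 0 < (√l - 1) ^ 2 := by
    have : 0 < √l - 1 := by linarith
    positivity
  rw [integral_freePoissonMeasure hl, intervalIntegral.integral_congr
    (g := fun t => √(4 * l - (t - (1 + l)) ^ 2)) fun t ht => ?_,
    integral_sqrt_four_mul_sub_sq hl0]
  · field_simp
  · rw [Set.uIcc_of_le hab] at ht
    exact div_mul_cancel₀ _ (ha.trans_le ht.1).ne'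

theorem integral_inv_freePoissonMeasure {l : ℝ} (hl : 1 < l)
    (hmass : ∫ _, (1 : ℝ) ∂freePoissonMeasure l 1 = 1) :
    ∫ t, t⁻¹ ∂freePoissonMeasure l 1 = 1 / (l - 1) := by
  have hl0 : 0 < l := by linarith
  have hab : (√l - 1) ^ 2 ≤ (√l + 1) ^ 2 := by nlinarith [Real.sqrt_nonneg l]
  have h1 : 1 < √l := by rwa [Real.lt_sqrt zero_le_one, one_pow]
  have ha : 0 < (√l - 1) ^ 2 := by
    have : 0 < √l - 1 := by linarith
    positivity
  rw [integral_freePoissonMeasure hl] at hmass ⊢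
  have hsemi := integral_sqrt_four_mul_sub_sq hl0
  have hroot := four_mul_sub_sq_eq hl0.le
  set a := (√l - 1) ^ 2
  set b := (√l + 1) ^ 2
  have hne : ∀ t ∈ Set.uIcc a b, t ≠ 0 := fun t ht => by
    rw [Set.uIcc_of_le hab] at ht
    exact (ha.trans_le ht.1).ne'
  have hne' : ∀ t ∈ Set.Icc a b, t ≠ 0 := fun t ht => (ha.trans_le ht.1).ne'
  have hI0 : IntervalIntegrable (fun t => √(4 * l - (t - (1 + l)) ^ 2)) volume a b :=
    Continuous.intervalIntegrable (by fun_prop) _ _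
  have hI1 : IntervalIntegrable (fun t => √(4 * l - (t - (1 + l)) ^ 2) / t * 1) volume a b :=
    ContinuousOn.intervalIntegrable (by fun_prop (disch := assumption))
  have hI2 : IntervalIntegrable (fun t => √(4 * l - (t - (1 + l)) ^ 2) / t * t⁻¹) volume a b :=
    ContinuousOn.intervalIntegrable (by fun_prop (disch := assumption))
  have hFTC := intervalIntegral.integral_eq_sub_of_hasDerivAt_of_le hab
    (f := fun t => (4 * l - (t - (1 + l)) ^ 2) * √(4 * l - (t - (1 + l)) ^ 2) / t)
    (f' := fun t => (-2) * √(4 * l - (t - (1 + l)) ^ 2) +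
      (1 + l) * (√(4 * l - (t - (1 + l)) ^ 2) / t * 1) +
      (l - 1) ^ 2 * (√(4 * l - (t - (1 + l)) ^ 2) / t * t⁻¹))
    (by fun_prop (disch := assumption))
    (fun t ht => by
      have ht0 : t ≠ 0 := (ha.trans ht.1).ne'
      have hw : 0 < 4 * l - (t - (1 + l)) ^ 2 := by
        rw [hroot]
        exact mul_pos (sub_pos.2 ht.1) (sub_pos.2 ht.2)
      have hwd : HasDerivAt (fun t => 4 * l - (t - (1 + l)) ^ 2) (-(2 * (t - (1 + l)))) t := by
        have := (((hasDerivAt_id t).sub_const (1 + l)).pow 2).const_sub (4 * l)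
        simpa using this
      have hd := (hwd.mul (hwd.sqrt hw.ne')).div (hasDerivAt_id t) ht0
      refine hd.congr_deriv ?_
      simp only [id, Pi.mul_apply]
      have hr := Real.sq_sqrt hw.le
      have hr0 : √(4 * l - (t - (1 + l)) ^ 2) ≠ 0 := (Real.sqrt_pos.2 hw).ne'
      set r := √(4 * l - (t - (1 + l)) ^ 2)
      field_simp
      linear_combination (t * (t - (1 + l))) * hr)
    (((hI0.const_mul _).add (hI1.const_mul _)).add (hI2.const_mul _))
  rw [intervalIntegral.integral_add ((hI0.const_mul _).add (hI1.const_mul _)) (hI2.const_mul _),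
    intervalIntegral.integral_add (hI0.const_mul _) (hI1.const_mul _),
    intervalIntegral.integral_const_mul, intervalIntegral.integral_const_mul,
    intervalIntegral.integral_const_mul, hsemi, hroot a, hroot b, sub_self, sub_self] at hFTC
  have hpi := Real.pi_pos
  have hl1 : l - 1 ≠ 0 := by linarith
  rw [div_eq_iff (by positivity)] at hmass ⊢
  rw [hmass] at hFTC
  apply mul_left_cancel₀ (pow_ne_zero 2 hl1)
  have hcancel : (l - 1) ^ 2 * (1 / (l - 1) * (2 * Real.pi)) = (l - 1) * (2 * Real.pi) := by
    field_simp
  rw [hcancel]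
  linear_combination hFTC

theorem blockCum_eq_of_sort_eq {A : Type*} (R : ∀ n, (Fin n → A) → ℂ) {n : ℕ} (x : Fin n → A)
    {B : Finset (Fin n)} {L : List (Fin n)} (h : B.sort (· ≤ ·) = L) :
    blockCum R x B = R L.length fun j => x (L.get j) := by
  subst h
  have key : ∀ (m : ℕ) (hm : m = (B.sort (· ≤ ·)).length),
      (R m fun j => x ((B.sort (· ≤ ·)).get (Fin.cast hm j))) =
        R (B.sort (· ≤ ·)).length fun j => x ((B.sort (· ≤ ·)).get j) := by
    rintro _ rfl
    rfl
  exact key _ _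

theorem blockCum_singleton {A : Type*} (R : ∀ n, (Fin n → A) → ℂ) {n : ℕ} (x : Fin n → A)
    (i : Fin n) : blockCum R x {i} = R 1 fun _ => x i := by
  rw [blockCum_eq_of_sort_eq R x (Finset.sort_singleton _ i)]
  refine congrArg (R 1) (funext fun j => ?_)
  fin_cases j
  rfl

theorem mem_NC {n : ℕ} {P : Finset (Finset (Fin n))} :
    P ∈ NC n ↔ IsPartition P ∧ IsNonCrossing P := by
  simp [NC]

theorem isNonCrossing_of_le_three {n : ℕ} (hn : n ≤ 3) (P : Finset (Finset (Fin n))) :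
    IsNonCrossing P := by
  intro B₁ _ B₂ _ a _ b _ c _ d _ hab hbc hcd
  rw [Fin.lt_def] at hab hbc hcd
  omega

theorem NC_one : NC 1 = {{{0}}} := by
  ext P
  rw [mem_NC, and_iff_left (isNonCrossing_of_le_three (by norm_num) P)]
  simp only [IsPartition, ExistsUnique, mem_singleton]
  revert P
  decide

theorem NC_two : NC 2 = {{{0, 1}}, {{0}, {1}}} := by
  ext P
  rw [mem_NC, and_iff_left (isNonCrossing_of_le_three (by norm_num) P)]
  simp only [IsPartition, ExistsUnique, mem_singleton, mem_insert]
  revert P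
  decide

theorem MomentCumulant.cumulant_one {A : Type*} [Monoid A] {φ : A → ℂ}
    {R : ∀ n, (Fin n → A) → ℂ} (h : MomentCumulant φ R) (x : A) :
    R 1 (fun _ => x) = φ x := by
  have h1 := h 1 fun _ => x
  simpa [NC_one, tprod, partCum, blockCum_singleton] using h1.symm

theorem MomentCumulant.apply_mul {A : Type*} [Monoid A] {φ : A → ℂ}
    {R : ∀ n, (Fin n → A) → ℂ} (h : MomentCumulant φ R) (x y : A) :
    φ (x * y) = R 2 ![x, y] + φ x * φ y := by
  have hne : ({{0, 1}} : Finset (Finset (Fin 2))) ≠ {{0}, {1}} := by decide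
  have hne' : ({0} : Finset (Fin 2)) ≠ {1} := by decide
  have hsort : ({0, 1} : Finset (Fin 2)).sort (· ≤ ·) = [0, 1] := by
    rw [sort_insert (· ≤ ·) (by simp) (by simp), sort_singleton]
  have hpair : blockCum R ![x, y] {0, 1} = R 2 ![x, y] := by
    rw [blockCum_eq_of_sort_eq R _ hsort]
    refine congrArg (R 2) (funext fun j => ?_)
    fin_cases j <;> rfl
  have h2 := h 2 ![x, y]
  rw [NC_two, sum_pair hne] at h2
  simp only [partCum, prod_singleton, prod_pair hne', hpair, blockCum_singleton,
    h.cumulant_one] at h2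
  simpa [tprod] using h2

end

/-- for `X` free Poisson with rate `l > 1` and jump size `1`,
`R_2(X⁻¹, X) = −1/(l−1) = −R_1(X⁻¹)`. -/
theorem freePoisson_mixed_second_cumulant
    {A : Type*} [NormedRing A] [StarRing A] [CStarRing A] [CompleteSpace A]
    [NormedAlgebra ℂ A] [StarModule ℂ A]
    (φ : A →ₗ[ℂ] ℂ) (R : ∀ n, (Fin n → A) → ℂ)
    (hst : IsState φ) (hfa : Faithful φ) (htr : Tracial φ)
    (hmc : MomentCumulant (⇑φ) R)
    (X : A) (hXsa : IsSelfAdjoint X) (hU : IsUnit X) (l : ℝ) (hl : 1 < l)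
    (hmom : HasMoments (⇑φ) X (freePoissonMeasure l 1)) :
    R 2 ![Ring.inverse X, X] = -(1 / ((l : ℂ) - 1)) ∧
      R 2 ![Ring.inverse X, X] = - R 1 (fun _ => Ring.inverse X) := by
  have hμ := ae_mem_Icc_freePoissonMeasure hl.le
  have hmass : ∫ _, (1 : ℝ) ∂freePoissonMeasure l 1 = 1 := by
    have h := hmom 0
    simp only [pow_zero, hst.1] at h
    exact_mod_cast h.symm
  have : MeasureTheory.IsProbabilityMeasure (freePoissonMeasure l 1) := by
    rw [MeasureTheory.isProbabilityMeasure_iff_real]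
    simpa using hmass
  have h1 : 1 < √l := by rwa [Real.lt_sqrt zero_le_one, one_pow]
  have ha : 0 < (√l - 1) ^ 2 := pow_pos (sub_pos.2 h1) 2
  have hX : φ X = l := by
    have h := hmom 1
    simp only [pow_one, integral_id_freePoissonMeasure hl] at h
    exact h
  have hY : φ (Ring.inverse X) = 1 / ((l : ℂ) - 1) := by
    rw [apply_inverse_eq_integral_inv hst hXsa hU hmom ha hμ,
      integral_inv_freePoissonMeasure hl hmass]
    push_cast
    rfl
  have h2 := hmc.apply_mul (Ring.inverse X) X
  rw [Ring.inverse_mul_cancel _ hU, hst.1, hX, hY] at h2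
  have hl1 : (l : ℂ) - 1 ≠ 0 := by exact_mod_cast (sub_pos.2 hl).ne'
  have hR : R 2 ![Ring.inverse X, X] = -(1 / ((l : ℂ) - 1)) := by
    rw [← sub_eq_iff_eq_add] at h2
    rw [← h2]
    field_simp
    ring
  exact ⟨hR, by rw [hR, hmc.cumulant_one, hY]⟩

end FreeProbLukacs
end
end
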